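/- The domination number of C_10 □ P_12 is exactly 28. -/

import Mathlib

open SimpleGraph

/-- Closed neighborhood of a set of vertices: the set plus everything adjacent to it. -/
def closedNbhd {V : Type*} (G : SimpleGraph V) (S : Set V) : Set V :=
  {v | v ∈ S ∨ ∃ u ∈ S, G.Adj u v}

/-- Wasted domination of a set. -/
noncomputable def waste {V : Type*} (G : SimpleGraph V) (S : Set V) : ℤ :=
  5 * S.ncard - (closedNbhd G S).ncard

/-- A dominating set. -/
def IsDomSet {V : Type*} (G : SimpleGraph V) (S : Set V) : Prop :=
  ∀ v, v ∈ S ∨ ∃ u ∈ S, G.Adj u v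

/-- The domination number of a graph. -/
noncomputable def domNum {V : Type*} (G : SimpleGraph V) : ℕ :=
  sInf {k | ∃ S : Set V, S.Finite ∧ S.ncard = k ∧ IsDomSet G S}


namespace Dom28

/-- Enumerate all bit strings whose support contains the complement of `D`, of weight at most `m`. -/
noncomputable def ext (D : ℕ) (f : ℕ → ℕ → Bool) (i : ℕ) : ℕ → ℕ → Bool :=
  Nat.rec (fun m acc => f m acc)
    (fun i ih m acc =>
      Bool.and
        (cond (Nat.beq (Nat.land (Nat.shiftRight D i) 1) 0) true (ih m (Nat.mul 2 acc)))
        (Nat.rec true (fun n _ => ih n (Nat.succ (Nat.mul 2 acc))) m)) i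

def cnt (c : ℕ → Bool) : ℕ → ℕ
  | 0 => 0
  | i + 1 => cnt c i + (c i).toNat

def mask (c : ℕ → Bool) : ℕ → ℕ → ℕ
  | 0, acc => acc
  | i + 1, acc => mask c i (2 * acc + (c i).toNat)

lemma ext_sound (D : ℕ) (f : ℕ → ℕ → Bool) (c : ℕ → Bool) (i : ℕ) : ∀ m acc,
    ext D f i m acc = true → (∀ t < i, D.testBit t = false → c t = true) → cnt c i ≤ m →
    f (m - cnt c i) (mask c i acc) = true := by
  induction i with
  | zero => intro m acc h _ _; exact h
  | succ i ih =>
    intro m acc h hc hm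
    have h' : (cond (Nat.beq (Nat.land (Nat.shiftRight D i) 1) 0) true
        (ext D f i m (2 * acc))
        && (Nat.rec true (fun n _ => ext D f i n (2 * acc + 1)) m : Bool)) = true := h
    rw [Bool.and_eq_true] at h'
    obtain ⟨h1, h2⟩ := h'
    cases hci : c i with
    | false =>
      have hb : D.testBit i = true := by
        by_contra hb
        have := hc i (by omega) (by simpa using hb)
        simp [this] at hci
      have hb2 : Nat.beq (Nat.land (Nat.shiftRight D i) 1) 0 = false := by
        rw [Nat.testBit_eq_decide_div_mod_eq] at hb
        have e : Nat.land (Nat.shiftRight D i) 1 = (D >>> i) % 2 := Nat.and_one_is_mod _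
        rw [e, Nat.shiftRight_eq_div_pow]
        have := of_decide_eq_true hb
        rw [this]; rfl
      rw [hb2] at h1
      have := ih m (2 * acc) h1 (fun t ht => hc t (by omega)) (by simp [cnt, hci] at hm; exact hm)
      simpa [cnt, mask, hci] using this
    | true =>
      simp only [cnt, hci, Bool.toNat_true] at hm
      obtain ⟨n, rfl⟩ : ∃ n, m = n + 1 := ⟨m - 1, by omega⟩
      have := ih n (2 * acc + 1) h2 (fun t ht => hc t (by omega)) (by omega)
      simpa [cnt, mask, hci] using this

def dmask (p a : ℕ) : ℕ :=
  Nat.lor p (Nat.lor a (Nat.lor (Nat.shiftLeft a 1) (Nat.lor (Nat.shiftRight a 9)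
    (Nat.lor (Nat.shiftRight a 1) (Nat.shiftLeft a 9)))))

noncomputable def go (p a cp ca W : ℕ) (f : ℕ → ℕ → Bool) : Bool :=
  cond (Nat.ble (cp + 3 * ca) (W + 10))
    (ext (dmask p a) f 10 (W + 10 - (cp + 3 * ca)) 0) true

noncomputable def check (k : ℕ) : ℕ → ℕ → ℕ → ℕ → ℕ → Bool :=
  Nat.rec (fun p a cp ca W => go p a cp ca (W + 8) (fun _ _ => false))
    (fun _ ih p a cp ca W => go p a cp ca W
      (fun rem b => ih a b ca (W + 10 - (cp + 3 * ca) - rem) rem)) k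

noncomputable def checkAll : Bool :=
  ext 1023 (fun rem a => check 6 0 a 0 (4 - rem) (3 + rem)) 10 4 0

lemma checkAll_true : checkAll = true := by decide +kernel

def Cover (P A B : ℕ → Bool) : Prop :=
  ∀ t < 10, P t = true ∨ A t = true ∨ A ((t + 1) % 10) = true ∨ A ((t + 9) % 10) = true ∨ B t = true

lemma testBit_mask (c : ℕ → Bool) (i : ℕ) : ∀ acc t,
    (mask c i acc).testBit t = if t < i then c t else acc.testBit (t - i) := by
  induction i with
  | zero => intro acc t; simp [mask]
  | succ i ih =>
    intro acc t
    rw [mask, ih]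
    by_cases h : t < i
    · simp [h, Nat.lt_succ_of_lt h]
    · by_cases h2 : t = i
      · subst h2
        cases c t <;> simp [Nat.testBit_zero] <;> omega
      · have h3 : ¬ t < i + 1 := by omega
        obtain ⟨s, rfl⟩ : ∃ s, t = i + 1 + s := ⟨t - (i + 1), by omega⟩
        have e : i + 1 + s - i = s + 1 := by omega
        have e2 : i + 1 + s - (i + 1) = s := by omega
        rw [if_neg h, if_neg h3, e, e2, Nat.testBit_succ]
        congr 1
        cases c i <;> simp <;> omega

lemma dmask_testBit (P A B : ℕ → Bool) (h : Cover P A B) (t : ℕ) (ht : t < 10)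
    (hd : (dmask (mask P 10 0) (mask A 10 0)).testBit t = false) : B t = true := by
  have e : dmask (mask P 10 0) (mask A 10 0) = (mask P 10 0) ||| ((mask A 10 0) |||
    (((mask A 10 0) <<< 1) ||| (((mask A 10 0) >>> 9) ||| (((mask A 10 0) >>> 1) |||
    ((mask A 10 0) <<< 9))))) := rfl
  rw [e] at hd
  simp only [Nat.testBit_or, Nat.testBit_shiftLeft, Nat.testBit_shiftRight, testBit_mask,
    Bool.or_eq_false_iff] at hd
  have := h t ht
  interval_cases t <;> simp_all

lemma go_sound (P A B : ℕ → Bool) (W : ℕ) (f : ℕ → ℕ → Bool)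
    (hg : go (mask P 10 0) (mask A 10 0) (cnt P 10) (cnt A 10) W f = true)
    (h : Cover P A B) (hW : cnt P 10 + 3 * cnt A 10 + cnt B 10 ≤ W + 10) :
    f (W + 10 - (cnt P 10 + 3 * cnt A 10) - cnt B 10) (mask B 10 0) = true := by
  unfold go at hg
  have hb : Nat.ble (cnt P 10 + 3 * cnt A 10) (W + 10) = true := by
    rw [Nat.ble_eq]; omega
  rw [hb, cond_true] at hg
  exact ext_sound _ f B 10 _ _ hg (fun t ht hd => dmask_testBit P A B h t ht hd) (by omega)

lemma check_succ (k : ℕ) (P A B : ℕ → Bool) (W W' : ℕ)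
    (hg : check (k + 1) (mask P 10 0) (mask A 10 0) (cnt P 10) (cnt A 10) W = true)
    (h : Cover P A B) (hW : cnt P 10 + 3 * cnt A 10 + cnt B 10 + W' = W + 10) :
    check k (mask A 10 0) (mask B 10 0) (cnt A 10) (cnt B 10) W' = true := by
  have := go_sound P A B W _ hg h (by omega)
  have e1 : W + 10 - (cnt P 10 + 3 * cnt A 10) - cnt B 10 = W' := by omega
  have e2 : W + 10 - (cnt P 10 + 3 * cnt A 10) - W' = cnt B 10 := by omega
  rw [e1] at this
  simp only [e2] at this
  exact this

lemma check_zero (P A B : ℕ → Bool) (W : ℕ)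
    (hg : check 0 (mask P 10 0) (mask A 10 0) (cnt P 10) (cnt A 10) W = true)
    (h : Cover P A B) (hW : cnt P 10 + 3 * cnt A 10 + cnt B 10 ≤ W + 8 + 10) : False := by
  have s7 := go_sound P A B (W + 8) (fun _ _ => false) hg h hW
  exact absurd s7 (by simp)

lemma check_start (A : ℕ → Bool) (hA : cnt A 10 ≤ 4) :
    check 6 0 (mask A 10 0) 0 (cnt A 10) (7 - cnt A 10) = true := by
  have h := checkAll_true
  unfold checkAll at h
  generalize hf : check 6 = f at h ⊢
  have := ext_sound 1023 (fun rem a => f 0 a 0 (4 - rem) (3 + rem)) A 10 4 0 h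
    (fun t ht hd => by
      exfalso; revert hd; revert t; decide) hA
  have e1 : 4 - (4 - cnt A 10) = cnt A 10 := by omega
  have e2 : 3 + (4 - cnt A 10) = 7 - cnt A 10 := by omega
  simp only [e1, e2] at this
  exact this

attribute [irreducible] check mask cnt

lemma cover_cnt (P A B : ℕ → Bool) (h : Cover P A B) :
    10 ≤ cnt P 10 + 3 * cnt A 10 + cnt B 10 := by
  have key : ∀ t < 10, 1 ≤ (P t).toNat + (A t).toNat + (A ((t + 1) % 10)).toNat
      + (A ((t + 9) % 10)).toNat + (B t).toNat := by
    intro t ht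
    rcases h t ht with h | h | h | h | h <;> rw [h] <;> simp <;> omega
  have k0 := key 0 (by norm_num)
  have k1 := key 1 (by norm_num)
  have k2 := key 2 (by norm_num)
  have k3 := key 3 (by norm_num)
  have k4 := key 4 (by norm_num)
  have k5 := key 5 (by norm_num)
  have k6 := key 6 (by norm_num)
  have k7 := key 7 (by norm_num)
  have k8 := key 8 (by norm_num)
  have k9 := key 9 (by norm_num)
  norm_num at k0 k1 k2 k3 k4 k5 k6 k7 k8 k9
  simp only [cnt]
  linarith

lemma exists_check : ∃ C : ℕ → (ℕ → Bool) → (ℕ → Bool) → ℕ → Prop,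
    (∀ A Z : ℕ → Bool, (∀ t, Z t = false) → cnt A 10 ≤ 4 → ∀ W, cnt A 10 + W = 7 → C 6 Z A W) ∧
    (∀ k P A B W W', C (k + 1) P A W → Cover P A B →
      cnt P 10 + 3 * cnt A 10 + cnt B 10 + W' = W + 10 → C k A B W') ∧
    (∀ P A B W, C 0 P A W → Cover P A B →
      cnt P 10 + 3 * cnt A 10 + cnt B 10 ≤ W + 8 + 10 → False) := by
  refine ⟨fun k P A W => check k (mask P 10 0) (mask A 10 0) (cnt P 10) (cnt A 10) W = true,
    ?_, ?_, ?_⟩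
  · intro A Z hZ hA W hW
    have hr0 : Z = fun _ => false := funext hZ
    have hm0 : mask Z 10 0 = 0 := by rw [hr0]; simp [mask]
    have hc0 : cnt Z 10 = 0 := by rw [hr0]; simp [cnt]
    have e0 : W = 7 - cnt A 10 := by omega
    beta_reduce
    rw [hm0, hc0, e0]
    exact check_start A hA
  · intro k P A B W W' h1 h2 h3
    exact check_succ k P A B W W' h1 h2 h3
  · intro P A B W h1 h2 h3
    exact check_zero P A B W h1 h2 h3

lemma half (r : ℕ → ℕ → Bool) (h0 : ∀ t, r 0 t = false)
    (hc : ∀ j < 7, Cover (r j) (r (j + 1)) (r (j + 2)))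
    (a : ℕ → ℕ) (ha : ∀ j, a j = cnt (r j) 10)
    (h1 : a 1 + (a 0 + 3 * a 1 + a 2) + (a 1 + 3 * a 2 + a 3) + (a 2 + 3 * a 3 + a 4)
      + (a 3 + 3 * a 4 + a 5) + (a 4 + 3 * a 5 + a 6) + (a 5 + 3 * a 6 + a 7) ≤ 67)
    (h2 : a 1 + (a 0 + 3 * a 1 + a 2) + (a 1 + 3 * a 2 + a 3) + (a 2 + 3 * a 3 + a 4)
      + (a 3 + 3 * a 4 + a 5) + (a 4 + 3 * a 5 + a 6) + (a 5 + 3 * a 6 + a 7)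
      + (a 6 + 3 * a 7 + a 8) ≤ 85) : False := by
  have hk : ∀ j < 7, 10 ≤ a j + 3 * a (j + 1) + a (j + 2) := by
    intro j hj; rw [ha, ha, ha]; exact cover_cnt _ _ _ (hc j hj)
  have hr0 : r 0 = fun _ => false := funext h0
  have hc0 : cnt (r 0) 10 = 0 := by rw [hr0]; simp [cnt]
  have ha0 : a 0 = 0 := by rw [ha, hc0]
  have k0 := hk 0 (by norm_num)
  have k1 := hk 1 (by norm_num)
  have k2 := hk 2 (by norm_num)
  have k3 := hk 3 (by norm_num)
  have k4 := hk 4 (by norm_num)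
  have k5 := hk 5 (by norm_num)
  have k6 := hk 6 (by norm_num)
  norm_num at k0 k1 k2 k3 k4 k5 k6
  have b1 : 4 * a 1 ≤ 17 := by linarith
  have b2 : a 1 ≤ 4 := by clear * - b1; omega
  obtain ⟨w0, hw0⟩ : ∃ w, a 1 + w = 7 := Nat.le.dest (by linarith)
  obtain ⟨C, C6, Cs, C0⟩ := exists_check
  have s := C6 (r 1) (r 0) h0 (by rw [← ha]; exact b2) w0 (by rw [← ha]; exact hw0)
  obtain ⟨w1, hw1⟩ : ∃ w, a 0 + 3 * a 1 + a 2 + w = w0 + 10 := Nat.le.dest (by linarith)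
  obtain ⟨w2, hw2⟩ : ∃ w, a 1 + 3 * a 2 + a 3 + w = w1 + 10 := Nat.le.dest (by linarith)
  obtain ⟨w3, hw3⟩ : ∃ w, a 2 + 3 * a 3 + a 4 + w = w2 + 10 := Nat.le.dest (by linarith)
  obtain ⟨w4, hw4⟩ : ∃ w, a 3 + 3 * a 4 + a 5 + w = w3 + 10 := Nat.le.dest (by linarith)
  obtain ⟨w5, hw5⟩ : ∃ w, a 4 + 3 * a 5 + a 6 + w = w4 + 10 := Nat.le.dest (by linarith)
  obtain ⟨w6, hw6⟩ : ∃ w, a 5 + 3 * a 6 + a 7 + w = w5 + 10 := Nat.le.dest (by linarith)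
  have hw7 : a 6 + 3 * a 7 + a 8 ≤ w6 + 8 + 10 := by linarith
  simp only [ha] at hw1 hw2 hw3 hw4 hw5 hw6 hw7
  have s1 := Cs 5 (r 0) (r 1) (r 2) _ w1 s (hc 0 (by norm_num)) hw1
  have s2 := Cs 4 (r 1) (r 2) (r 3) _ w2 s1 (hc 1 (by norm_num)) hw2
  have s3 := Cs 3 (r 2) (r 3) (r 4) _ w3 s2 (hc 2 (by norm_num)) hw3
  have s4 := Cs 2 (r 3) (r 4) (r 5) _ w4 s3 (hc 3 (by norm_num)) hw4
  have s5 := Cs 1 (r 4) (r 5) (r 6) _ w5 s4 (hc 4 (by norm_num)) hw5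
  have s6 := Cs 0 (r 5) (r 6) (r 7) _ w6 s5 (hc 5 (by norm_num)) hw6
  exact C0 (r 6) (r 7) (r 8) w6 s6 (hc 6 (by norm_num)) hw7

lemma lower (r : ℕ → ℕ → Bool) (h0 : ∀ t, r 0 t = false) (h13 : ∀ t, r 13 t = false)
    (hc : ∀ j < 12, Cover (r j) (r (j + 1)) (r (j + 2))) :
    28 ≤ ∑ j ∈ Finset.range 12, cnt (r (j + 1)) 10 := by
  have hc1 : ∀ j < 7, Cover (r j) (r (j + 1)) (r (j + 2)) := fun j hj => hc j (by omega)
  have hc2 : ∀ j < 7, Cover (r (13 - j)) (r (13 - (j + 1))) (r (13 - (j + 2))) := by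
    intro j hj
    have := hc (11 - j) (by omega)
    have e1 : 11 - j + 1 = 13 - (j + 1) := by omega
    have e2 : 11 - j + 2 = 13 - j := by omega
    have e3 : 11 - j = 13 - (j + 2) := by omega
    rw [e1, e2, e3] at this
    intro t ht
    have := this t ht
    tauto
  by_contra hlt
  obtain ⟨a, ha⟩ : ∃ a : ℕ → ℕ, ∀ j, a j = cnt (r j) 10 := ⟨_, fun _ => rfl⟩
  simp only [← ha, Finset.sum_range_succ, Finset.sum_range_zero] at hlt
  rw [not_le, ← Nat.succ_le_iff, Nat.succ_eq_add_one] at hlt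
  norm_num at hlt
  have hk : ∀ j < 12, 10 ≤ a j + 3 * a (j + 1) + a (j + 2) := by
    intro j hj; rw [ha, ha, ha]; exact cover_cnt _ _ _ (hc j hj)
  have a0 : a 0 = 0 := by rw [ha, show r 0 = fun _ => false from funext h0]; simp [cnt]
  have a13 : a 13 = 0 := by rw [ha, show r 13 = fun _ => false from funext h13]; simp [cnt]
  have k0 := hk 0 (by norm_num)
  have k1 := hk 1 (by norm_num)
  have k2 := hk 2 (by norm_num)
  have k3 := hk 3 (by norm_num)
  have k4 := hk 4 (by norm_num)
  have k5 := hk 5 (by norm_num)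
  have k6 := hk 6 (by norm_num)
  have k7 := hk 7 (by norm_num)
  have k8 := hk 8 (by norm_num)
  have k9 := hk 9 (by norm_num)
  have k10 := hk 10 (by norm_num)
  have k11 := hk 11 (by norm_num)
  norm_num at k0 k1 k2 k3 k4 k5 k6 k7 k8 k9 k10 k11
  by_cases hs : a 1 + (a 0 + 3 * a 1 + a 2) + (a 1 + 3 * a 2 + a 3) + (a 2 + 3 * a 3 + a 4)
      + (a 3 + 3 * a 4 + a 5) + (a 4 + 3 * a 5 + a 6) + (a 5 + 3 * a 6 + a 7) ≤ 67
  · exact half r h0 hc1 a ha hs (by linarith)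
  · rw [not_le, ← Nat.succ_le_iff, Nat.succ_eq_add_one] at hs
    refine half (fun j => r (13 - j)) h13 hc2 (fun j => a (13 - j))
      (fun j => ha _) (by norm_num; linarith) (by norm_num; linarith)

lemma cnt_eq (c : ℕ → Bool) (n : ℕ) : cnt c n = ∑ t ∈ Finset.range n, (c t).toNat := by
  induction n with
  | zero => simp [cnt]
  | succ n ih => rw [cnt, ih, Finset.sum_range_succ]

lemma dom_lower (S : Set (Fin 10 × Fin 12))
    (hS : IsDomSet (cycleGraph 10 □ pathGraph 12) S) : 28 ≤ S.ncard := by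
  classical
  let r : ℕ → ℕ → Bool := fun j t =>
    if h : 1 ≤ j ∧ j ≤ 12 then decide ((Fin.ofNat 10 t, (⟨j - 1, by omega⟩ : Fin 12)) ∈ S)
    else false
  have hr : ∀ (i : Fin 10) (j : Fin 12), (i, j) ∈ S → ∀ a b, a = j.val + 1 → b = i.val →
      r a b = true := by
    rintro i j h a b rfl rfl
    simp only [r]
    rw [dif_pos (by omega)]
    simpa using h
  have hlow := lower r (by simp [r]) (by simp [r]) (by
    intro j hj t ht
    rcases hS (⟨t, ht⟩, ⟨j, hj⟩) with h | ⟨⟨u, v⟩, h, hadj⟩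
    · exact Or.inr (Or.inl (hr _ _ h _ _ rfl rfl))
    · rw [boxProd_adj] at hadj
      simp only at hadj
      rcases hadj with ⟨hu, hv⟩ | ⟨hv, hu⟩
      · subst hv
        rw [cycleGraph_adj'] at hu
        rcases hu with hu | hu
        · refine Or.inr (Or.inr (Or.inl (hr _ _ h _ _ rfl ?_)))
          rw [Fin.sub_def] at hu
          simp only at hu
          omega
        · refine Or.inr (Or.inr (Or.inr (Or.inl (hr _ _ h _ _ rfl ?_))))
          rw [Fin.sub_def] at hu
          simp only at hu
          omega
      · subst hu
        rw [pathGraph_adj] at hv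
        simp only at hv
        rcases hv with hv | hv
        · exact Or.inl (hr _ _ h _ _ hv.symm rfl)
        · exact Or.inr (Or.inr (Or.inr (Or.inr (hr _ _ h _ _ (by omega) rfl)))))
  have e : S.ncard = ∑ j ∈ Finset.range 12, cnt (r (j + 1)) 10 := by
    rw [Set.ncard_eq_toFinset_card', ← Set.filter_mem_univ_eq_toFinset, Finset.card_filter,
      Fintype.sum_prod_type_right, Finset.sum_range]
    refine Finset.sum_congr rfl fun j _ => ?_
    rw [cnt_eq, Finset.sum_range]
    refine Finset.sum_congr rfl fun i _ => ?_
    have : r (j.val + 1) i.val = decide ((i, j) ∈ S) := by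
      simp only [r]
      rw [dif_pos (by omega)]
      simp
    rw [this]
    by_cases h : (i, j) ∈ S <;> simp [h]
  omega

def F : Finset (Fin 10 × Fin 12) :=
  {(2,0),(4,0),(7,0),(9,0),(0,1),(5,1),(3,2),(8,2),(1,3),(6,3),(4,4),(9,4),(2,5),(7,5),
   (0,6),(5,6),(3,7),(8,7),(1,8),(6,8),(4,9),(9,9),(2,10),(7,10),(0,11),(3,11),(5,11),(8,11)}

lemma F_dom : ∀ v : Fin 10 × Fin 12, v ∈ F ∨ ∃ u ∈ F,
    (((u.1 - v.1).val = 1 ∨ (v.1 - u.1).val = 1) ∧ u.2 = v.2) ∨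
    ((u.2.val + 1 = v.2.val ∨ v.2.val + 1 = u.2.val) ∧ u.1 = v.1) := by
  decide +kernel

end Dom28

theorem stmt8 : domNum (cycleGraph 10 □ pathGraph 12) = 28 := by
  apply le_antisymm
  · refine Nat.sInf_le ⟨(Dom28.F : Set _), Finset.finite_toSet _, ?_, ?_⟩
    · rw [Set.ncard_coe_finset]; decide +kernel
    · intro v
      rcases Dom28.F_dom v with h | ⟨u, hu, h⟩
      · exact Or.inl (by simpa using h)
      · refine Or.inr ⟨u, by simpa using hu, ?_⟩
        rw [boxProd_adj, cycleGraph_adj', pathGraph_adj]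
        exact h
  · refine le_csInf ⟨_, Set.univ, Set.toFinite _, rfl, fun v => Or.inl trivial⟩ ?_
    rintro k ⟨S, -, rfl, hS⟩
    exact Dom28.dom_lower S hS
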